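/- Let d ≥ 2, α ∈ (0,2), and let ℓ be a regular global modulus of continuity that is not Dini, i.e. ∫₀¹ ℓ(u)/u du = ∞. Let R ∈ (0,1] and let h be a nonnegative function that is α-harmonic in D_{−ℓ} ∩ B(0,R), vanishes continuously on B(0,R) \ D_{−ℓ}, and satisfies h((R/2)·e_d) > 0. Then h(r·e_d)/r^{α/2} → ∞ as r → 0+; in particular, since 0 ∈ ∂D_{−ℓ} and δ_{D_{−ℓ}}(r·e_d) ≤ r, the standard boundary decay rate δ_{D_{−ℓ}}(x)^{α/2} fails for nonnegative α-harmonic functions in D_{−ℓ}. -/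

import Mathlib

open Metric MeasureTheory

/-- `gEll ℓ t = t·ℓ(t)` for `t > 0`, and `0` for `t ≤ 0`. -/
noncomputable def gEll (ℓ : ℝ → ℝ) (t : ℝ) : ℝ := if 0 < t then t * ℓ t else 0

/-- The special open set `D_{-ℓ} = {x : x_d > -Γ_ℓ(x̃)}`. -/
noncomputable def Dm (d : ℕ) (h0 : 0 < d) (ℓ : ℝ → ℝ) : Set (EuclideanSpace ℝ (Fin d)) :=
  {x | -gEll ℓ (x ⟨0, h0⟩) < x ⟨d - 1, Nat.sub_lt h0 Nat.one_pos⟩}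

/-- `h` is `α`-harmonic in `U`: the Poisson-kernel mean value property holds on every ball
whose closure is contained in `U`. -/
def AlphaHarmonicOn (d : ℕ) (α : ℝ) (h : EuclideanSpace ℝ (Fin d) → ℝ)
    (U : Set (EuclideanSpace ℝ (Fin d))) : Prop :=
  ∀ x₀ : EuclideanSpace ℝ (Fin d), ∀ ρ : ℝ, 0 < ρ → closedBall x₀ ρ ⊆ U →
    ∀ x ∈ ball x₀ ρ,
      IntegrableOn
        (fun y : EuclideanSpace ℝ (Fin d) =>
          ((ρ ^ 2 - dist x x₀ ^ 2) / (dist y x₀ ^ 2 - ρ ^ 2)) ^ (α / 2) *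
            dist x y ^ (-(d : ℝ)) * h y)
        {y : EuclideanSpace ℝ (Fin d) | ρ < dist y x₀} ∧
      h x = Real.Gamma ((d : ℝ) / 2) * Real.pi ^ (-(d : ℝ) / 2 - 1) *
          Real.sin (Real.pi * α / 2) *
        ∫ y in {y : EuclideanSpace ℝ (Fin d) | ρ < dist y x₀},
          ((ρ ^ 2 - dist x x₀ ^ 2) / (dist y x₀ ^ 2 - ρ ^ 2)) ^ (α / 2) *
            dist x y ^ (-(d : ℝ)) * h y

/-- The normalizing constant of the Poisson kernel. -/
noncomputable def poissonConst (d : ℕ) (α : ℝ) : ℝ :=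
  Real.Gamma ((d : ℝ) / 2) * Real.pi ^ (-(d : ℝ) / 2 - 1) * Real.sin (Real.pi * α / 2)

lemma poissonConst_pos {d : ℕ} (hd : 0 < d) {α : ℝ} (hα : α ∈ Set.Ioo (0 : ℝ) 2) :
    0 < poissonConst d α := by
  have h1 : 0 < Real.Gamma ((d : ℝ) / 2) := Real.Gamma_pos_of_pos (by positivity)
  have h2 : 0 < Real.sin (Real.pi * α / 2) := by
    apply Real.sin_pos_of_pos_of_lt_pi
    · have := hα.1; positivity
    · nlinarith [Real.pi_pos, hα.2]
  unfold poissonConst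
  positivity

/-- Lower bound for a nonnegative harmonic function obtained by restricting the Poisson
integral to finitely many disjoint sets. -/
lemma AlphaHarmonicOn.sum_le {d : ℕ} (hd : 0 < d) {α : ℝ} (hα : α ∈ Set.Ioo (0 : ℝ) 2)
    {h : EuclideanSpace ℝ (Fin d) → ℝ} (hnonneg : ∀ x, 0 ≤ h x)
    {U : Set (EuclideanSpace ℝ (Fin d))} (hharm : AlphaHarmonicOn d α h U)
    {x₀ x : EuclideanSpace ℝ (Fin d)} {ρ : ℝ} (hρ : 0 < ρ) (hU : closedBall x₀ ρ ⊆ U)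
    (hx : x ∈ ball x₀ ρ) {ι : Type*} (s : Finset ι) (Q : ι → Set (EuclideanSpace ℝ (Fin d)))
    (m : ι → ℝ) (hmeas : ∀ i ∈ s, MeasurableSet (Q i))
    (hdisj : Set.Pairwise (↑s) (Function.onFun Disjoint Q))
    (hfin : ∀ i ∈ s, volume (Q i) ≠ ⊤)
    (hsub : ∀ i ∈ s, ∀ y ∈ Q i, ρ < dist y x₀)
    (hm : ∀ i ∈ s, ∀ y ∈ Q i, m i ≤
      ((ρ ^ 2 - dist x x₀ ^ 2) / (dist y x₀ ^ 2 - ρ ^ 2)) ^ (α / 2) *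
        dist x y ^ (-(d : ℝ)) * h y) :
    poissonConst d α * ∑ i ∈ s, volume.real (Q i) * m i ≤ h x := by
  obtain ⟨hint, heq⟩ := hharm x₀ ρ hρ hU x hx
  rw [heq]
  refine mul_le_mul_of_nonneg_left ?_ (poissonConst_pos hd hα).le
  have hsub' : (⋃ i ∈ s, Q i) ⊆ {y : EuclideanSpace ℝ (Fin d) | ρ < dist y x₀} :=
    Set.iUnion₂_subset hsub
  have hint' : ∀ i ∈ s, IntegrableOn (fun y : EuclideanSpace ℝ (Fin d) =>
          ((ρ ^ 2 - dist x x₀ ^ 2) / (dist y x₀ ^ 2 - ρ ^ 2)) ^ (α / 2) *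
            dist x y ^ (-(d : ℝ)) * h y) (Q i) := fun i hi => hint.mono_set (hsub i hi)
  calc ∑ i ∈ s, volume.real (Q i) * m i
      ≤ ∑ i ∈ s, ∫ y in Q i, ((ρ ^ 2 - dist x x₀ ^ 2) / (dist y x₀ ^ 2 - ρ ^ 2)) ^ (α / 2) *
            dist x y ^ (-(d : ℝ)) * h y :=
        Finset.sum_le_sum fun i hi =>
          setIntegral_ge_of_const_le (hmeas i hi) (hfin i hi) (hm i hi) (hint' i hi)
    _ = _ := (integral_biUnion_finset s hmeas hdisj hint').symm
    _ ≤ _ := by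
        refine setIntegral_mono_set hint ?_ (Filter.Eventually.of_forall hsub')
        refine (ae_restrict_iff' (measurableSet_lt measurable_const (by fun_prop))).2 ?_
        refine Filter.Eventually.of_forall fun y hy => ?_
        have hy' : ρ < dist y x₀ := hy
        have hx' : dist x x₀ < ρ := hx
        have h1 : 0 ≤ ρ ^ 2 - dist x x₀ ^ 2 := by nlinarith [dist_nonneg (x := x) (y := x₀)]
        have h2 : 0 ≤ dist y x₀ ^ 2 - ρ ^ 2 := by nlinarith
        have := hnonneg y
        simp only [Pi.zero_apply]
        positivity

lemma not_summable_dyadic_of_not_dini {ℓ : ℝ → ℝ}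
    (hpos : ∀ r : ℝ, 0 < r → 0 < ℓ r)
    (hmono : ∀ s r : ℝ, 0 < s → s ≤ r → ℓ s ≤ ℓ r)
    (hnotDini : ∫⁻ u in Set.Ioc (0 : ℝ) 1, ENNReal.ofReal (ℓ u / u) = ⊤) :
    ¬ Summable fun n : ℕ => ℓ ((1 / 2) ^ n) := by
  intro hs
  have hcov : Set.Ioc (0 : ℝ) 1 ⊆ ⋃ n : ℕ, Set.Ioc ((1 / 2 : ℝ) ^ (n + 1)) ((1 / 2) ^ n) := by
    intro u hu
    obtain ⟨n, h1, h2⟩ :=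
      exists_nat_pow_near_of_lt_one (y := (1 / 2 : ℝ)) hu.1 hu.2 (by norm_num) (by norm_num)
    exact Set.mem_iUnion.2 ⟨n, h1, h2⟩
  have hpiece : ∀ n : ℕ, ∫⁻ u in Set.Ioc ((1 / 2 : ℝ) ^ (n + 1)) ((1 / 2) ^ n),
      ENNReal.ofReal (ℓ u / u) ≤ ENNReal.ofReal (ℓ ((1 / 2) ^ n)) := by
    intro n
    have ht : (0 : ℝ) < (1 / 2) ^ (n + 1) := by positivity
    calc _ ≤ ∫⁻ _ in Set.Ioc ((1 / 2 : ℝ) ^ (n + 1)) ((1 / 2) ^ n),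
          ENNReal.ofReal (ℓ ((1 / 2) ^ n) / (1 / 2) ^ (n + 1)) := by
          refine setLIntegral_mono' measurableSet_Ioc fun u hu => ENNReal.ofReal_le_ofReal ?_
          exact div_le_div₀ (hpos _ (by positivity)).le (hmono _ _ (ht.trans hu.1) hu.2) ht hu.1.le
      _ = ENNReal.ofReal (ℓ ((1 / 2) ^ n)) := by
          rw [setLIntegral_const, Real.volume_Ioc, ← ENNReal.ofReal_mul
            (div_nonneg (hpos _ (by positivity)).le ht.le)]
          congr 1
          field_simp
          ring
  have hlt : ∫⁻ u in Set.Ioc (0 : ℝ) 1, ENNReal.ofReal (ℓ u / u) < ⊤ :=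
    calc _ ≤ ∫⁻ u in ⋃ n : ℕ, Set.Ioc ((1 / 2 : ℝ) ^ (n + 1)) ((1 / 2) ^ n),
          ENNReal.ofReal (ℓ u / u) := lintegral_mono_set hcov
      _ ≤ ∑' n : ℕ, ∫⁻ u in Set.Ioc ((1 / 2 : ℝ) ^ (n + 1)) ((1 / 2) ^ n),
          ENNReal.ofReal (ℓ u / u) := lintegral_iUnion_le _ _
      _ ≤ ∑' n : ℕ, ENNReal.ofReal (ℓ ((1 / 2) ^ n)) := ENNReal.tsum_le_tsum hpiece
      _ < ⊤ := hs.tsum_ofReal_lt_top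
  exact hlt.ne hnotDini

/-- The box of side `t` in the directions other than `j` and of height `t * a / 4` below
`x_j = 0`, at distance `t` from the origin in direction `i`. -/
def sideBox {d : ℕ} (i j : Fin d) (t a : ℝ) : Set (EuclideanSpace ℝ (Fin d)) :=
  {y | ∀ k, y k ∈ Set.Ico (if k = j then -(t * a / 4) else if k = i then t else 0)
    (if k = j then 0 else if k = i then 2 * t else t)}

section sideBox

variable {d : ℕ} {i j : Fin d} {t a : ℝ}

lemma sideBox_eq_preimage : sideBox i j t a = (WithLp.ofLp : EuclideanSpace ℝ (Fin d) → _) ⁻¹'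
    (Set.univ.pi fun k => Set.Ico (if k = j then -(t * a / 4) else if k = i then t else 0)
      (if k = j then 0 else if k = i then 2 * t else t)) := by
  ext y
  simp [sideBox]

lemma measurableSet_sideBox : MeasurableSet (sideBox i j t a) := by
  rw [sideBox_eq_preimage]
  exact (MeasurableSet.univ_pi fun _ => measurableSet_Ico).preimage
    (PiLp.volume_preserving_ofLp (Fin d)).measurable

lemma volume_sideBox (ht : 0 ≤ t) (ha : 0 ≤ a) :
    volume (sideBox i j t a) = ENNReal.ofReal (t ^ d * (a / 4)) := by
  rw [sideBox_eq_preimage, (PiLp.volume_preserving_ofLp (Fin d)).measure_preimage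
    (MeasurableSet.univ_pi fun _ => measurableSet_Ico).nullMeasurableSet, Real.volume_pi_Ico]
  have hk : ∀ k : Fin d, ENNReal.ofReal ((if k = j then 0 else if k = i then 2 * t else t) -
      (if k = j then -(t * a / 4) else if k = i then t else 0)) =
      ENNReal.ofReal (t * if k = j then a / 4 else 1) := by
    intro k
    congr 1
    split_ifs <;> ring
  rw [Finset.prod_congr rfl fun k _ => hk k, ← ENNReal.ofReal_prod_of_nonneg
    fun k _ => by positivity]
  rw [Finset.prod_mul_distrib]
  simp

lemma sideBox_fst (hij : i ≠ j) {y : EuclideanSpace ℝ (Fin d)} (hy : y ∈ sideBox i j t a) :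
    t ≤ y i ∧ y i < 2 * t := by
  simpa [hij] using hy i

lemma sideBox_last {y : EuclideanSpace ℝ (Fin d)} (hy : y ∈ sideBox i j t a) :
    -(t * a / 4) ≤ y j ∧ y j < 0 := by
  simpa using hy j

lemma norm_sideBox_le (ht : 0 < t) (ha1 : a ≤ 1)
    {y : EuclideanSpace ℝ (Fin d)} (hy : y ∈ sideBox i j t a) : ‖y‖ ≤ 2 * d * t := by
  have hk : ∀ k, ‖y k‖ ≤ 2 * t := by
    intro k
    have hta : t * a ≤ t := mul_le_of_le_one_right ht.le ha1
    have := hy k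
    rw [Real.norm_eq_abs, abs_le]
    split_ifs at this <;> constructor <;> nlinarith [this.1, this.2]
  have hd : (1 : ℝ) ≤ d := by exact_mod_cast Nat.one_le_of_lt i.2
  have hsq : ‖y‖ ^ 2 ≤ d * (2 * t) ^ 2 := by
    rw [EuclideanSpace.norm_sq_eq]
    calc ∑ k, ‖y k‖ ^ 2 ≤ ∑ _k : Fin d, (2 * t) ^ 2 :=
          Finset.sum_le_sum fun k _ => pow_le_pow_left₀ (norm_nonneg _) (hk k) 2
      _ = _ := by simp
  refine abs_le_of_sq_le_sq' ?_ (by positivity) |>.2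
  nlinarith [sq_nonneg t, mul_nonneg (sub_nonneg.2 hd) (by positivity : 0 ≤ (d : ℝ) * t ^ 2)]

lemma disjoint_sideBox (hij : i ≠ j) {t' a' : ℝ} (htt : 2 * t' ≤ t) :
    Disjoint (sideBox i j t a) (sideBox i j t' a') := by
  rw [Set.disjoint_left]
  intro y h1 h2
  linarith [sideBox_fst hij h1, sideBox_fst hij h2]

end sideBox

/-- Every point of a side box lies in a ball of radius `ρ` contained in a half-space, at depth
comparable to the height of the box. -/
lemma exists_ball_of_mem_sideBox {d : ℕ} {i j : Fin d} (hij : i ≠ j) {t a ρ : ℝ} (ht : 0 < t)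
    (ha : 0 < a) (ha1 : a ≤ 1) (hρ : t * a / 16 ≤ ρ) {y : EuclideanSpace ℝ (Fin d)}
    (hy : y ∈ sideBox i j t a) :
    ∃ x₀ : EuclideanSpace ℝ (Fin d), dist y x₀ = ρ - t * a / 16 ∧
      ∀ z ∈ closedBall x₀ ρ, -((z i - t / 2) * a) < z j := by
  set v : EuclideanSpace ℝ (Fin d) := EuclideanSpace.single i a + EuclideanSpace.single j 1 with hv
  have hin : ∀ z : EuclideanSpace ℝ (Fin d), inner ℝ v z = a * z i + z j := by
    intro z
    simp [hv, inner_add_left, EuclideanSpace.inner_single_left]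
  have hNsq : ‖v‖ ^ 2 = a ^ 2 + 1 := by
    rw [← real_inner_self_eq_norm_sq, hin]
    simp [hv, hij, hij.symm]
    ring
  have hN0 : 0 < ‖v‖ := by
    by_contra hcon
    have : ‖v‖ = 0 := le_antisymm (not_lt.1 hcon) (norm_nonneg _)
    rw [this] at hNsq
    nlinarith
  have hN2 : ‖v‖ ≤ 2 := by nlinarith
  have hta : 0 < t * a := by positivity
  refine ⟨y + ((ρ - t * a / 16) / ‖v‖) • v, ?_, fun z hz => ?_⟩
  · rw [dist_self_add_right, norm_smul, norm_div, norm_norm, div_mul_cancel₀ _ hN0.ne',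
      Real.norm_of_nonneg (by linarith)]
  · set x₀ := y + ((ρ - t * a / 16) / ‖v‖) • v with hx₀
    have h1 : inner ℝ v x₀ = inner ℝ v y + (ρ - t * a / 16) * ‖v‖ := by
      rw [hx₀, inner_add_right, inner_smul_right, real_inner_self_eq_norm_sq]
      field_simp
    have h2 : -(‖v‖ * ρ) ≤ inner ℝ v (z - x₀) := by
      have h3 := neg_le_of_abs_le (abs_real_inner_le_norm v (z - x₀))
      have h4 : ‖z - x₀‖ ≤ ρ := by simpa [dist_eq_norm] using hz
      nlinarith
    rw [inner_sub_right, h1, hin, hin] at h2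
    have h5 := sideBox_fst hij hy
    have h6 := sideBox_last hy
    nlinarith

lemma mem_Dm_of_lt {d : ℕ} (h0 : 0 < d) {ℓ : ℝ → ℝ} (hpos : ∀ r : ℝ, 0 < r → 0 < ℓ r)
    (hmono : ∀ s r : ℝ, 0 < s → s ≤ r → ℓ s ≤ ℓ r) {t : ℝ} (ht : 0 < t)
    {z : EuclideanSpace ℝ (Fin d)}
    (hz : -((z ⟨0, h0⟩ - t) * ℓ t) < z ⟨d - 1, Nat.sub_lt h0 Nat.one_pos⟩) :
    z ∈ Dm d h0 ℓ := by
  have hlt := hpos t ht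
  simp only [Dm, Set.mem_ofPred_eq, gEll]
  rcases le_total (z ⟨0, h0⟩) t with h1 | h1
  · have : 0 < z ⟨d - 1, Nat.sub_lt h0 Nat.one_pos⟩ := by nlinarith
    split_ifs with h2
    · nlinarith [hpos _ h2]
    · linarith
  · rw [if_pos (ht.trans_le h1)]
    have := hmono t _ ht h1
    nlinarith

lemma mem_Dm_of_pos {d : ℕ} (h0 : 0 < d) {ℓ : ℝ → ℝ} (hpos : ∀ r : ℝ, 0 < r → 0 < ℓ r)
    {z : EuclideanSpace ℝ (Fin d)} (hz : 0 < z ⟨d - 1, Nat.sub_lt h0 Nat.one_pos⟩) :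
    z ∈ Dm d h0 ℓ := by
  simp only [Dm, Set.mem_ofPred_eq, gEll]
  split_ifs with h2
  · nlinarith [hpos _ h2]
  · linarith

/-- A nonnegative harmonic function that is positive at `p` is bounded below in every small ball
of fixed radius by a multiple of the `α / 2`-th power of the depth. -/
lemma AlphaHarmonicOn.exists_depth_bound {d : ℕ} (hd : 0 < d) {α : ℝ}
    (hα : α ∈ Set.Ioo (0 : ℝ) 2) {h : EuclideanSpace ℝ (Fin d) → ℝ} (hnonneg : ∀ x, 0 ≤ h x)
    {D : Set (EuclideanSpace ℝ (Fin d))} {R : ℝ} (hR : R ∈ Set.Ioc (0 : ℝ) 1)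
    (hharm : AlphaHarmonicOn d α h (D ∩ ball 0 R))
    (hcont : ContinuousOn h (ball (0 : EuclideanSpace ℝ (Fin d)) R))
    {p : EuclideanSpace ℝ (Fin d)} (hpR : ‖p‖ = R / 2) (hp : 0 < h p) :
    ∃ c₁ : ℝ, 0 < c₁ ∧ ∀ x₀ : EuclideanSpace ℝ (Fin d), ‖x₀‖ ≤ R / 8 →
      closedBall x₀ (R / 16) ⊆ D → ∀ x ∈ ball x₀ (R / 16),
        c₁ * ((R / 16) ^ 2 - dist x x₀ ^ 2) ^ (α / 2) ≤ h x := by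
  have hR0 : 0 < R := hR.1
  have hR1 : R ≤ 1 := hR.2
  have hpm : p ∈ ball (0 : EuclideanSpace ℝ (Fin d)) R := by
    rw [mem_ball_zero_iff]; linarith
  have hcp : ContinuousAt h p := hcont.continuousAt (isOpen_ball.mem_nhds hpm)
  obtain ⟨η₀, hη₀, hη₀h⟩ := Metric.eventually_nhds_iff_ball.1
    (hcp.eventually (lt_mem_nhds (half_lt_self hp)))
  set η := min η₀ (R / 16)
  have hη : 0 < η := lt_min hη₀ (by linarith)
  have hvol : 0 < volume.real (ball p η) :=
    ENNReal.toReal_pos (measure_ball_pos _ _ hη).ne' measure_ball_lt_top.ne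
  refine ⟨poissonConst d α * (volume.real (ball p η) * (h p / 2)), ?_, ?_⟩
  · have := poissonConst_pos hd hα
    positivity
  intro x₀ hx₀ hD x hx
  have hx' : dist x x₀ < R / 16 := hx
  have hpx₀ : 3 * R / 8 ≤ dist p x₀ ∧ dist p x₀ ≤ 5 * R / 8 := by
    rw [dist_eq_norm]
    exact ⟨by linarith [norm_sub_norm_le p x₀], by linarith [norm_sub_le p x₀]⟩
  have hball : ∀ y ∈ ball p η, R / 16 < dist y x₀ ∧ dist y x₀ ≤ 3 * R / 4 := by
    intro y hy
    have h1 : dist y p < R / 16 := lt_of_lt_of_le hy (min_le_right _ _)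
    exact ⟨by linarith [dist_triangle p y x₀, dist_comm p y], by linarith [dist_triangle y p x₀]⟩
  have hU : closedBall x₀ (R / 16) ⊆ D ∩ ball 0 R := by
    refine Set.subset_inter hD fun z hz => ?_
    have hz' : dist z x₀ ≤ R / 16 := hz
    rw [mem_ball]
    linarith [dist_triangle z x₀ 0, dist_zero_right x₀]
  have hnum : 0 < (R / 16) ^ 2 - dist x x₀ ^ 2 := by
    nlinarith [dist_nonneg (x := x) (y := x₀)]
  have key := hharm.sum_le hd hα hnonneg (by linarith) hU hx {()} (fun _ => ball p η)
    (fun _ => ((R / 16) ^ 2 - dist x x₀ ^ 2) ^ (α / 2) * (h p / 2))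
    (fun _ _ => measurableSet_ball) (by simp) (fun _ _ => measure_ball_lt_top.ne)
    (fun _ _ y hy => (hball y hy).1) ?_
  · simp only [Finset.sum_const, Finset.card_singleton, one_smul] at key
    calc _ = _ := by ring
      _ ≤ _ := key
  · intro _ _ y hy
    obtain ⟨h1, h2⟩ := hball y hy
    have hyh : h p / 2 ≤ h y := (hη₀h y (ball_subset_ball (min_le_left _ _) hy)).le
    have hden : 0 < dist y x₀ ^ 2 - (R / 16) ^ 2 := by nlinarith
    have hden1 : dist y x₀ ^ 2 - (R / 16) ^ 2 ≤ 1 := by nlinarith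
    have hxy0 : 0 < dist x y := by linarith [dist_triangle y x x₀, dist_comm x y]
    have hxy1 : dist x y ≤ 1 := by linarith [dist_triangle x x₀ y, dist_comm y x₀]
    have hk : 1 ≤ dist x y ^ (-(d : ℝ)) :=
      Real.one_le_rpow_of_pos_of_le_one_of_nonpos hxy0 hxy1 (by simp)
    have hα0 := hα.1
    have hpow : ((R / 16) ^ 2 - dist x x₀ ^ 2) ^ (α / 2) ≤
        (((R / 16) ^ 2 - dist x x₀ ^ 2) / (dist y x₀ ^ 2 - (R / 16) ^ 2)) ^ (α / 2) :=
      Real.rpow_le_rpow hnum.le (le_div_self hnum.le hden hden1) (by positivity)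
    calc _ ≤ (((R / 16) ^ 2 - dist x x₀ ^ 2) / (dist y x₀ ^ 2 - (R / 16) ^ 2)) ^ (α / 2) *
          (h p / 2) := by gcongr
      _ ≤ (((R / 16) ^ 2 - dist x x₀ ^ 2) / (dist y x₀ ^ 2 - (R / 16) ^ 2)) ^ (α / 2) *
          dist x y ^ (-(d : ℝ)) * h y := by
        gcongr
        exact le_mul_of_one_le_right (by positivity) hk

/-- Estimates on a side box seen from the ball of radius `ρ` centred at `(ρ + r / 2) e_j`. -/
lemma sideBox_dist_bounds {d : ℕ} {i j : Fin d} {t a ρ r B : ℝ} (ht : 0 < t)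
    (ha : 0 < a) (ha1 : a ≤ 1) (hρ : 0 < ρ) (hρ1 : ρ ≤ 1 / 2) (hr : 0 < r) (hr1 : r ≤ 1)
    (hrt : r ≤ t * a) (htB : t ≤ B * a) {y : EuclideanSpace ℝ (Fin d)}
    (hy : y ∈ sideBox i j t a) :
    ρ < dist y (EuclideanSpace.single j (ρ + r / 2)) ∧
    dist y (EuclideanSpace.single j (ρ + r / 2)) ^ 2 - ρ ^ 2 ≤
      (4 * d ^ 2 * B + 2) * (t * a) ∧
    0 < dist (EuclideanSpace.single j r) y ∧
    dist (EuclideanSpace.single j r) y ≤ (2 * d + 1) * t := by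
  obtain ⟨hj1, hj2⟩ := sideBox_last hy
  have hn := norm_sideBox_le ht ha1 hy
  have hta : 0 < t * a := by positivity
  have hd2 : dist y (EuclideanSpace.single j (ρ + r / 2)) ^ 2 =
      ‖y‖ ^ 2 - 2 * ((ρ + r / 2) * y j) + (ρ + r / 2) ^ 2 := by
    rw [dist_eq_norm, norm_sub_sq_real, EuclideanSpace.inner_single_right]
    simp
  refine ⟨?_, ?_, ?_, ?_⟩
  · apply lt_of_pow_lt_pow_left₀ 2 dist_nonneg
    rw [hd2]
    nlinarith [sq_nonneg ‖y‖, mul_pos hρ hr]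
  · rw [hd2]
    have h1 : ‖y‖ ^ 2 ≤ 4 * d ^ 2 * B * (t * a) := by
      calc ‖y‖ ^ 2 ≤ (2 * d * t) ^ 2 := pow_le_pow_left₀ (norm_nonneg _) hn 2
        _ = 4 * d ^ 2 * t * t := by ring
        _ ≤ 4 * d ^ 2 * t * (B * a) := by gcongr
        _ = _ := by ring
    nlinarith [mul_pos hρ hr]
  · rw [dist_pos]
    rintro rfl
    simp at hj2
    linarith
  · rw [dist_eq_norm]
    have h1 := norm_sub_le (EuclideanSpace.single j r) y
    have h2 : ‖EuclideanSpace.single j r‖ = r := by simp [abs_of_pos hr]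
    nlinarith

theorem stmt_4 (d : ℕ) (hd : 2 ≤ d) (α : ℝ) (hα : α ∈ Set.Ioo (0 : ℝ) 2) (ℓ : ℝ → ℝ)
    (hpos : ∀ r : ℝ, 0 < r → 0 < ℓ r)
    (hmono : ∀ s r : ℝ, 0 < s → s ≤ r → ℓ s ≤ ℓ r)
    (hlim : Filter.Tendsto ℓ (nhdsWithin 0 (Set.Ioi 0)) (nhds 0))
    (c : ℝ) (hc : 1 ≤ c)
    (halmost : ∀ s r : ℝ, 0 < s → s ≤ r → ℓ r / r ≤ c * (ℓ s / s))
    (hdiff1 : ∀ r : ℝ, 0 < r → DifferentiableAt ℝ ℓ r)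
    (hdiff2 : ∀ r : ℝ, 0 < r → DifferentiableAt ℝ (deriv ℓ) r)
    (Creg : ℝ) (hCreg : 0 < Creg)
    (hreg : ∀ r : ℝ, 0 < r → r * deriv ℓ r + |r ^ 2 * deriv (deriv ℓ) r| ≤ Creg * ℓ r)
    (hnotDini : ∫⁻ u in Set.Ioc (0 : ℝ) 1, ENNReal.ofReal (ℓ u / u) = ⊤)
    (R : ℝ) (hR : R ∈ Set.Ioc (0 : ℝ) 1)
    (h : EuclideanSpace ℝ (Fin d) → ℝ) (hnonneg : ∀ x, 0 ≤ h x)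
    (hharm : AlphaHarmonicOn d α h (Dm d (by omega) ℓ ∩ ball 0 R))
    (hvanish : ∀ x ∈ ball (0 : EuclideanSpace ℝ (Fin d)) R \ Dm d (by omega) ℓ, h x = 0)
    (hcont : ContinuousOn h (ball (0 : EuclideanSpace ℝ (Fin d)) R))
    (hp : 0 < h (EuclideanSpace.single (⟨d - 1, by omega⟩ : Fin d) (R / 2))) :
    Filter.Tendsto
      (fun r : ℝ => h (EuclideanSpace.single (⟨d - 1, by omega⟩ : Fin d) r) / r ^ (α / 2))
      (nhdsWithin 0 (Set.Ioi 0)) Filter.atTop := by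
  have hd0 : 0 < d := by omega
  have hα0 : 0 < α := hα.1
  have hR0 : 0 < R := hR.1
  have hR1 : R ≤ 1 := hR.2
  set i : Fin d := ⟨0, hd0⟩ with hi
  set j : Fin d := ⟨d - 1, Nat.sub_lt hd0 Nat.one_pos⟩ with hj
  have hij : i ≠ j := by simp only [hi, hj, ne_eq, Fin.mk.injEq]; omega
  have hp_norm : ‖EuclideanSpace.single j (R / 2)‖ = R / 2 := by
    rw [PiLp.norm_single, Real.norm_of_nonneg (by linarith)]
  obtain ⟨c₁, hc₁, hdepth⟩ := hharm.exists_depth_bound hd0 hα hnonneg hR hcont hp_norm hp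
  have hbox : ∀ t : ℝ, 0 < t → ℓ (t / 2) ≤ 1 → 2 * d * t ≤ R / 16 →
      ∀ y ∈ sideBox i j t (ℓ (t / 2)), c₁ * (t * ℓ (t / 2) * R / 256) ^ (α / 2) ≤ h y := by
    intro t ht ha1 htR y hy
    have ha := hpos (t / 2) (by positivity)
    have hd1 : (1 : ℝ) ≤ d := by exact_mod_cast hd0
    have hta1 : t * ℓ (t / 2) ≤ t := mul_le_of_le_one_right ht.le ha1
    have hta : 0 < t * ℓ (t / 2) := by positivity
    have htR' : t ≤ R / 16 := by nlinarith
    obtain ⟨x₀, hyx₀, hx₀D⟩ := exists_ball_of_mem_sideBox (ρ := R / 16) hij ht ha ha1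
      (by linarith) hy
    have hx₀n : ‖x₀‖ ≤ R / 8 := by
      have h1 : ‖x₀‖ ≤ ‖y‖ + dist y x₀ := by
        rw [dist_eq_norm]
        linarith [norm_sub_norm_le x₀ y, norm_sub_rev x₀ y]
      linarith [norm_sideBox_le ht ha1 hy]
    refine le_trans ?_ (hdepth x₀ hx₀n (fun z hz => mem_Dm_of_lt hd0 hpos hmono
      (half_pos ht) (hx₀D z hz)) y ?_)
    · gcongr
      rw [hyx₀]
      nlinarith
    · rw [mem_ball, hyx₀]
      linarith
  set B : ℝ := 2 * c / ℓ 1 with hB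
  have hℓ1 := hpos 1 one_pos
  have hB0 : 0 < B := by positivity
  have htB : ∀ t : ℝ, 0 < t → t ≤ 1 → t ≤ B * ℓ (t / 2) := by
    intro t ht ht1
    have h1 := halmost (t / 2) 1 (by positivity) (by linarith)
    have ha := hpos (t / 2) (by positivity)
    rw [div_one, div_div_eq_mul_div, ← mul_div_assoc, le_div_iff₀ ht] at h1
    rw [hB, div_mul_eq_mul_div, le_div_iff₀ hℓ1]
    linarith
  set C : ℝ := 4 * d ^ 2 * B + 2 with hC
  have hC0 : 0 < C := by positivity
  set c₂ : ℝ := ((R / 16) ^ 2 / (32 * C)) ^ (α / 2) * (2 * d + 1 : ℝ) ^ (-(d : ℝ)) * c₁ with hc₂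
  have hc₂0 : 0 < c₂ := by positivity
  have hkernel : ∀ t r : ℝ, 0 < t → ℓ (t / 2) ≤ 1 → 2 * d * t ≤ R / 16 → 0 < r →
      r ≤ t * ℓ (t / 2) → r ≤ R / 16 → ∀ y ∈ sideBox i j t (ℓ (t / 2)),
      c₂ * r ^ (α / 2) * (t ^ d)⁻¹ ≤
        (((R / 16) ^ 2 - dist (EuclideanSpace.single j r)
          (EuclideanSpace.single j (R / 16 + r / 2)) ^ 2) /
          (dist y (EuclideanSpace.single j (R / 16 + r / 2)) ^ 2 - (R / 16) ^ 2)) ^ (α / 2) *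
        dist (EuclideanSpace.single j r) y ^ (-(d : ℝ)) * h y := by
    intro t r ht ha1 htR hr hrt hrR y hy
    have ha := hpos (t / 2) (by positivity)
    have hd1 : (1 : ℝ) ≤ d := by exact_mod_cast hd0
    have ht1 : t ≤ 1 := by nlinarith
    obtain ⟨h1, h2, h3, h4⟩ := sideBox_dist_bounds (ρ := R / 16) ht ha ha1 (by linarith)
      (by linarith) hr (by linarith) hrt (htB t ht ht1) hy
    have h5 : dist (EuclideanSpace.single j r : EuclideanSpace ℝ (Fin d))
        (EuclideanSpace.single j (R / 16 + r / 2)) = R / 16 - r / 2 := by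
      rw [PiLp.dist_single_same, Real.dist_eq, abs_sub_comm, abs_of_nonneg] <;> linarith
    have h6 : (0 : ℝ) < dist y (EuclideanSpace.single j (R / 16 + r / 2)) ^ 2 - (R / 16) ^ 2 := by
      nlinarith
    have h7 : R / 16 * r / 2 / (C * (t * ℓ (t / 2))) ≤
        ((R / 16) ^ 2 - dist (EuclideanSpace.single j r : EuclideanSpace ℝ (Fin d))
          (EuclideanSpace.single j (R / 16 + r / 2)) ^ 2) /
          (dist y (EuclideanSpace.single j (R / 16 + r / 2)) ^ 2 - (R / 16) ^ 2) := by
      rw [h5]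
      refine div_le_div₀ ?_ ?_ h6 h2 <;> nlinarith
    have h8 : (2 * d + 1 : ℝ) ^ (-(d : ℝ)) * (t ^ d)⁻¹ ≤
        dist (EuclideanSpace.single j r) y ^ (-(d : ℝ)) := by
      calc (2 * d + 1 : ℝ) ^ (-(d : ℝ)) * (t ^ d)⁻¹ = ((2 * d + 1 : ℝ) * t) ^ (-(d : ℝ)) := by
            rw [Real.mul_rpow (by positivity) ht.le, Real.rpow_neg ht.le, Real.rpow_natCast]
        _ ≤ _ := Real.rpow_le_rpow_of_nonpos h3 h4 (by simp)
    calc c₂ * r ^ (α / 2) * (t ^ d)⁻¹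
        = (R / 16 * r / 2 / (C * (t * ℓ (t / 2)))) ^ (α / 2) *
          ((2 * d + 1 : ℝ) ^ (-(d : ℝ)) * (t ^ d)⁻¹) *
          (c₁ * (t * ℓ (t / 2) * R / 256) ^ (α / 2)) := by
          have h9 : (R / 16 * r / 2 / (C * (t * ℓ (t / 2)))) ^ (α / 2) *
              (t * ℓ (t / 2) * R / 256) ^ (α / 2) =
              ((R / 16) ^ 2 / (32 * C)) ^ (α / 2) * r ^ (α / 2) := by
            rw [← Real.mul_rpow (by positivity) (by positivity),
              ← Real.mul_rpow (by positivity) hr.le]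
            congr 1
            field_simp
            norm_num
          rw [hc₂]
          linear_combination -(2 * d + 1 : ℝ) ^ (-(d : ℝ)) * c₁ * (t ^ d)⁻¹ * h9
      _ ≤ _ := by
          have h9 := le_trans (by positivity) h7
          gcongr
          exact hbox t ht ha1 htR y hy
  have hK := poissonConst_pos hd0 hα
  have hpow0 : Filter.Tendsto (fun n : ℕ => (1 / 2 : ℝ) ^ n) Filter.atTop (nhds 0) :=
    tendsto_pow_atTop_nhds_zero_of_lt_one (by norm_num) (by norm_num)
  obtain ⟨n₀, hn₀⟩ : ∃ n₀ : ℕ, ∀ n ≥ n₀,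
      ℓ ((1 / 2) ^ n / 2) ≤ 1 ∧ 2 * d * (1 / 2 : ℝ) ^ n ≤ R / 16 := by
    rw [← Filter.eventually_atTop]
    have h1 : Filter.Tendsto (fun n : ℕ => (1 / 2 : ℝ) ^ n / 2) Filter.atTop
        (nhdsWithin 0 (Set.Ioi 0)) := by
      refine tendsto_nhdsWithin_iff.2 ⟨by simpa using hpow0.div_const 2, ?_⟩
      exact Filter.Eventually.of_forall fun n => by
        rw [Set.mem_Ioi]; positivity
    have h2 : Filter.Tendsto (fun n : ℕ => 2 * d * (1 / 2 : ℝ) ^ n) Filter.atTop (nhds 0) := by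
      simpa using hpow0.const_mul (2 * d : ℝ)
    exact ((hlim.comp h1).eventually (ge_mem_nhds one_pos)).and
      (h2.eventually (ge_mem_nhds (by positivity)))
  set t : ℕ → ℝ := fun k => (1 / 2) ^ (k + n₀) with ht
  have ht0 : ∀ k, 0 < t k := fun k => by positivity
  have hta1 : ∀ k, ℓ (t k / 2) ≤ 1 := fun k => (hn₀ _ (Nat.le_add_left _ _)).1
  have htR : ∀ k, 2 * d * t k ≤ R / 16 := fun k => (hn₀ _ (Nat.le_add_left _ _)).2
  have hℓt : ∀ k, 0 < ℓ (t k / 2) := fun k => hpos _ (half_pos (ht0 k))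
  have hdisj : Pairwise (Function.onFun Disjoint fun k => sideBox i j (t k) (ℓ (t k / 2))) := by
    refine (pairwise_disjoint_on _).2 fun m n hmn => disjoint_sideBox hij ?_
    calc 2 * t n ≤ 2 * (1 / 2) ^ (m + 1 + n₀) :=
          mul_le_mul_of_nonneg_left (pow_le_pow_of_le_one (by norm_num) (by norm_num)
            (by omega)) (by norm_num)
      _ = t m := by simp only [ht]; ring
  have hdiv : Filter.Tendsto (fun N : ℕ => ∑ k ∈ Finset.range N, ℓ (t k / 2))
      Filter.atTop Filter.atTop := by
    refine (not_summable_iff_tendsto_nat_atTop_of_nonneg fun k => (hℓt k).le).1 ?_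
    have h1 : (fun k => ℓ (t k / 2)) = fun k => ℓ ((1 / 2) ^ (k + (n₀ + 1))) := by
      ext k
      simp only [ht]
      congr 1
      ring
    rw [h1, summable_nat_add_iff (f := fun n => ℓ ((1 / 2) ^ n))]
    exact not_summable_dyadic_of_not_dini hpos hmono hnotDini
  refine Filter.tendsto_atTop.2 fun M => ?_
  obtain ⟨N, hN⟩ := ((hdiv.const_mul_atTop
    (show 0 < poissonConst d α * (c₂ / 4) by positivity)).eventually_ge_atTop M).exists
  have hsmall : ∀ᶠ r in nhdsWithin (0 : ℝ) (Set.Ioi 0),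
      ∀ k ∈ Finset.range N, r ≤ t k * ℓ (t k / 2) :=
    (Filter.eventually_all_finset _).2 fun k _ =>
      nhdsWithin_le_nhds (ge_mem_nhds (mul_pos (ht0 k) (hℓt k)))
  have hsmallR : ∀ᶠ r in nhdsWithin (0 : ℝ) (Set.Ioi 0), r ≤ R / 16 :=
    nhdsWithin_le_nhds (ge_mem_nhds (by positivity))
  filter_upwards [hsmall, hsmallR, self_mem_nhdsWithin] with r hrt hrR hr
  have hr0 : 0 < r := hr
  rw [le_div_iff₀ (by positivity)]
  have hU : closedBall (EuclideanSpace.single j (R / 16 + r / 2)) (R / 16) ⊆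
      Dm d hd0 ℓ ∩ ball 0 R := by
    intro z hz
    rw [mem_closedBall, dist_eq_norm] at hz
    have hn : ‖(EuclideanSpace.single j (R / 16 + r / 2) : EuclideanSpace ℝ (Fin d))‖ =
        R / 16 + r / 2 := by
      rw [PiLp.norm_single, Real.norm_of_nonneg (by linarith)]
    refine ⟨mem_Dm_of_pos hd0 hpos ?_, ?_⟩
    · have h1 := (PiLp.norm_apply_le _ j).trans hz
      simp only [PiLp.sub_apply, PiLp.single_apply, if_true, Real.norm_eq_abs,
        abs_le] at h1
      change 0 < z j
      linarith
    · rw [mem_ball_zero_iff]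
      linarith [norm_sub_norm_le z (EuclideanSpace.single j (R / 16 + r / 2))]
  have hx : EuclideanSpace.single j r ∈
      ball (EuclideanSpace.single j (R / 16 + r / 2)) (R / 16) := by
    rw [mem_ball, PiLp.dist_single_same, Real.dist_eq, abs_lt]
    constructor <;> linarith
  have hd1 : (1 : ℝ) ≤ d := by exact_mod_cast hd0
  have key := hharm.sum_le hd0 hα hnonneg (by positivity) hU hx (Finset.range N)
    (fun k => sideBox i j (t k) (ℓ (t k / 2))) (fun k => c₂ * r ^ (α / 2) * (t k ^ d)⁻¹)
    (fun _ _ => measurableSet_sideBox) (fun m _ n _ hmn => hdisj hmn)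
    (fun k _ => by
      rw [volume_sideBox (ht0 k).le (hℓt k).le]
      exact ENNReal.ofReal_ne_top)
    (fun k hk y hy => (sideBox_dist_bounds (ht0 k) (hℓt k) (hta1 k) (by positivity)
      (by linarith) hr0 (by linarith) (hrt k hk)
      (htB _ (ht0 k) (by nlinarith [htR k, ht0 k])) hy).1)
    (fun k hk y hy => hkernel _ r (ht0 k) (hta1 k) (htR k) hr0 (hrt k hk) hrR y hy)
  refine le_trans ?_ key
  calc M * r ^ (α / 2)
      ≤ poissonConst d α * (c₂ / 4) * (∑ k ∈ Finset.range N, ℓ (t k / 2)) * r ^ (α / 2) := by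
        gcongr
    _ = _ := by
        rw [mul_assoc, mul_assoc, Finset.sum_mul, Finset.mul_sum]
        congr 1
        refine Finset.sum_congr rfl fun k _ => ?_
        rw [Measure.real, volume_sideBox (ht0 k).le (hℓt k).le, ENNReal.toReal_ofReal
          (mul_nonneg (pow_nonneg (ht0 k).le d) (div_nonneg (hℓt k).le (by norm_num)))]
        have := (pow_pos (ht0 k) d).ne'
        field_simp
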